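/- (Chapman–Kolmogorov equation) Let p be a good heat kernel for L^κ. Then for all s, t > 0 and x, y ∈ ℝ^d, ∫_{ℝ^d} p(t,x,z) p(s,z,y) dz = p(t+s,x,y). -/

import Mathlib

open MeasureTheory Filter Set

attribute [local instance] Classical.propDecidable

noncomputable def Phi (φ : ℝ → ℝ) (r : ℝ) : ℝ :=
  if r ≤ 1 then r ^ 2 / (2 * ∫ s in Set.Ioo (0:ℝ) r, s / φ s)
  else (1 / (2 * ∫ s in Set.Ioo (0:ℝ) 1, s / φ s)) * r ^ 2

noncomputable def theta (d : ℕ) (φ : ℝ → ℝ) (b β : ℝ) (r : ℝ) : ℝ :=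
  if r ≤ 1 then 1 / (r ^ d * Phi φ r)
  else if β < 1 then Real.exp (-b * r ^ β)
  else r ^ (-(d : ℝ) - 1) * Real.exp (-(b / 5) * r)

noncomputable def Gfun (d : ℕ) (φ : ℝ → ℝ) (b β : ℝ) (Φinv : ℝ → ℝ)
    (t : ℝ) (x : EuclideanSpace ℝ (Fin d)) : ℝ :=
  if x = 0 then 1 / (t * Φinv t ^ d)
  else min (1 / (t * Φinv t ^ d)) (theta d φ b β ‖x‖)

noncomputable def Gtil (d : ℕ) (φ : ℝ → ℝ) (Φinv : ℝ → ℝ)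
    (t : ℝ) (x : EuclideanSpace ℝ (Fin d)) : ℝ :=
  if x = 0 then 1 / (t * Φinv t ^ d)
  else min (1 / (t * Φinv t ^ d)) (1 / (‖x‖ ^ d * Phi φ ‖x‖))

noncomputable def Leps (d : ℕ)
    (κ : EuclideanSpace ℝ (Fin d) → EuclideanSpace ℝ (Fin d) → ℝ) (J : ℝ → ℝ)
    (ε : ℝ) (f : EuclideanSpace ℝ (Fin d) → ℝ) (x : EuclideanSpace ℝ (Fin d)) : ℝ :=
  ∫ z in {z : EuclideanSpace ℝ (Fin d) | ε < ‖z‖}, (f (x + z) - f x) * (κ x z * J ‖z‖)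

structure PhiInvSpec (φ Φinv : ℝ → ℝ) : Prop where
  pos : ∀ t : ℝ, 0 < t → 0 < Φinv t
  right_inv : ∀ t : ℝ, 0 < t → Phi φ (Φinv t) = t
  left_inv : ∀ r : ℝ, 0 < r → Φinv (Phi φ r) = r

structure HKAssumptions (d : ℕ) (φ J : ℝ → ℝ) (a₁ α₁ C₀ a b β : ℝ)
    (κ : EuclideanSpace ℝ (Fin d) → EuclideanSpace ℝ (Fin d) → ℝ)
    (κ₀ κ₁ κ₂ δ : ℝ) : Prop where
  hd : 1 ≤ d
  φ_cont : ContinuousOn φ (Set.Icc 0 1)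
  φ_mono : StrictMonoOn φ (Set.Icc 0 1)
  φ_zero : φ 0 = 0
  a₁_pos : 0 < a₁
  α₁_pos : 0 < α₁
  α₁_le : α₁ ≤ 2
  hLS : ∀ r R : ℝ, 0 < r → r ≤ R → R ≤ 1 → a₁ * (R / r) ^ α₁ ≤ φ R / φ r
  hI : MeasureTheory.IntegrableOn (fun s => s / φ s) (Set.Ioo (0:ℝ) 1)
  hC₀ : C₀ = ∫ s in Set.Ioo (0:ℝ) 1, s / φ s
  J_pos : ∀ r : ℝ, 0 < r → 0 < J r
  J_cont : ContinuousOn J (Set.Ioi 0)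
  J_anti : AntitoneOn J (Set.Ioi 0)
  J_diff : ∀ r : ℝ, 0 < r → DifferentiableAt ℝ J r
  ha : 1 ≤ a
  hb : 0 < b
  β_pos : 0 < β
  β_le : β ≤ 1
  hJ1_low : ∀ r : ℝ, 0 < r → r ≤ 1 → a⁻¹ / (r ^ d * φ r) ≤ J r
  hJ1_up : ∀ r : ℝ, 0 < r → r ≤ 1 → J r ≤ a / (r ^ d * φ r)
  hJ1_exp : ∀ r : ℝ, 1 < r → J r ≤ a * Real.exp (-b * r ^ β)
  hJ2 : AntitoneOn (fun r => -(deriv J r) / r) (Set.Ioi 0)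
  κ_meas : Measurable (Function.uncurry κ)
  κ₀_pos : 0 < κ₀
  κ₁_pos : 0 < κ₁
  κ₂_pos : 0 < κ₂
  δ_pos : 0 < δ
  δ_lt : δ < 1
  κ_low : ∀ x z, κ₀ ≤ κ x z
  κ_up : ∀ x z, κ x z ≤ κ₁
  κ_sym : ∀ x z, κ x z = κ x (-z)
  κ_holder : ∀ x y z, |κ x z - κ y z| ≤ κ₂ * ‖x - y‖ ^ δ

structure GoodHeatKernel (d : ℕ) (φ J : ℝ → ℝ) (b β : ℝ) (Φinv : ℝ → ℝ)
    (κ : EuclideanSpace ℝ (Fin d) → EuclideanSpace ℝ (Fin d) → ℝ)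
    (p : ℝ → EuclideanSpace ℝ (Fin d) → EuclideanSpace ℝ (Fin d) → ℝ) : Prop where
  cont : ContinuousOn
      (fun q : ℝ × EuclideanSpace ℝ (Fin d) × EuclideanSpace ℝ (Fin d) => p q.1 q.2.1 q.2.2)
      (Set.Ioi (0:ℝ) ×ˢ (Set.univ : Set (EuclideanSpace ℝ (Fin d) × EuclideanSpace ℝ (Fin d))))
  eqn : ∀ t : ℝ, 0 < t → ∀ x y : EuclideanSpace ℝ (Fin d), x ≠ y →
      ∃ L : ℝ, Filter.Tendsto (fun ε => Leps d κ J ε (fun x' => p t x' y) x)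
          (nhdsWithin 0 (Set.Ioi 0)) (nhds L)
        ∧ HasDerivAt (fun s => p s x y) L t
  upper : ∀ T : ℝ, 1 ≤ T → ∃ c : ℝ, 0 < c ∧ ∀ t : ℝ, 0 < t → t ≤ T →
      ∀ x y, p t x y ≤ c * t * Gfun d φ b β Φinv t (x - y)
  frac : ∀ T : ℝ, 1 ≤ T → ∃ c' : ℝ, 0 < c' ∧ ∀ ε : ℝ, 0 < ε → ε ≤ 1 →
      ∀ t : ℝ, 0 < t → t ≤ T → ∀ x y, x ≠ y →
      |Leps d κ J ε (fun x' => p t x' y) x| ≤ c' * Gtil d φ Φinv t (x - y)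
  approx : ∀ f : EuclideanSpace ℝ (Fin d) → ℝ, (∃ M, ∀ x, |f x| ≤ M) →
      UniformContinuous f → ∀ η : ℝ, 0 < η → ∃ t₀ : ℝ, 0 < t₀ ∧
      ∀ t : ℝ, 0 < t → t < t₀ → ∀ x, |(∫ y, p t x y * f y) - f x| ≤ η

section HeatKernel

variable {d : ℕ} {φ J : ℝ → ℝ} {a₁ α₁ C₀ a b β : ℝ}
  {κ : EuclideanSpace ℝ (Fin d) → EuclideanSpace ℝ (Fin d) → ℝ}
  {κ₀ κ₁ κ₂ δ : ℝ} {Φinv : ℝ → ℝ}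
  {p : ℝ → EuclideanSpace ℝ (Fin d) → EuclideanSpace ℝ (Fin d) → ℝ}

theorem HKAssumptions.φ_pos (H : HKAssumptions d φ J a₁ α₁ C₀ a b β κ κ₀ κ₁ κ₂ δ)
    {r : ℝ} (hr : 0 < r) (hr1 : r ≤ 1) : 0 < φ r := by
  have := H.φ_mono (left_mem_Icc.2 zero_le_one) ⟨hr.le, hr1⟩ hr
  rwa [H.φ_zero] at this

theorem HKAssumptions.Phi_le (H : HKAssumptions d φ J a₁ α₁ C₀ a b β κ κ₀ κ₁ κ₂ δ)
    {r : ℝ} (hr : 0 < r) (hr1 : r ≤ 1) : Phi φ r ≤ φ r := by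
  have hφ := H.φ_pos hr hr1
  have hint : ∫ s in Ioo (0:ℝ) r, s / φ r = r ^ 2 / 2 / φ r := by
    rw [← integral_Ioc_eq_integral_Ioo, ← intervalIntegral.integral_of_le hr.le,
      intervalIntegral.integral_div, integral_id]
    simp
  have hle : r ^ 2 / 2 / φ r ≤ ∫ s in Ioo (0:ℝ) r, s / φ s := by
    rw [← hint]
    refine setIntegral_mono_on ?_ (H.hI.mono_set (Ioo_subset_Ioo_right hr1))
      measurableSet_Ioo fun s hs => ?_
    · exact ((continuous_id.div_const _).integrableOn_Icc (a := 0) (b := r)).mono_set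
        Ioo_subset_Icc_self
    · have hs1 : s ≤ 1 := hs.2.le.trans hr1
      exact div_le_div_of_nonneg_left hs.1.le (H.φ_pos hs.1 hs1)
        (H.φ_mono.monotoneOn ⟨hs.1.le, hs1⟩ ⟨hr.le, hr1⟩ hs.2.le)
  have hpos : 0 < r ^ 2 / 2 / φ r := by positivity
  have hI : 0 < ∫ s in Ioo (0:ℝ) r, s / φ s := hpos.trans_le hle
  rw [Phi, if_pos hr1, div_le_iff₀ (by positivity)]
  rw [div_div, div_le_iff₀ (by positivity)] at hle
  linarith

theorem HKAssumptions.exists_le_Φinv (H : HKAssumptions d φ J a₁ α₁ C₀ a b β κ κ₀ κ₁ κ₂ δ)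
    (HΦ : PhiInvSpec φ Φinv) {t₁ : ℝ} (ht₁ : 0 < t₁) :
    ∃ ρ, 0 < ρ ∧ ∀ t, t₁ ≤ t → ρ ≤ Φinv t := by
  obtain ⟨η, hη, hη'⟩ := Metric.continuousWithinAt_iff.1
    (H.φ_cont 0 (left_mem_Icc.2 zero_le_one)) t₁ ht₁
  refine ⟨min η 1, by positivity, fun t ht => ?_⟩
  by_contra! hlt
  have htpos : 0 < t := ht₁.trans_le ht
  have hpos := HΦ.pos t htpos
  have h1 : Φinv t ≤ 1 := (hlt.trans_le (min_le_right _ _)).le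
  have h2 := H.Phi_le hpos h1
  rw [HΦ.right_inv t htpos] at h2
  have h3 := @hη' (Φinv t) ⟨hpos.le, h1⟩ (by
    rw [Real.dist_eq, sub_zero, abs_of_pos hpos]; exact hlt.trans_le (min_le_left _ _))
  rw [Real.dist_eq, H.φ_zero, sub_zero] at h3
  linarith [le_abs_self (φ (Φinv t))]

theorem exp_neg_mul_rpow_le {b β : ℝ} (hb : 0 < b) (hβ : 0 < β) (m : ℕ) :
    ∃ C, 0 < C ∧ ∀ r : ℝ, 1 ≤ r → Real.exp (-b * r ^ β) ≤ C * (1 + r) ^ (-(m : ℝ)) := by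
  obtain ⟨n, hn⟩ := exists_nat_ge ((m : ℝ) / β)
  rw [div_le_iff₀ hβ] at hn
  refine ⟨n.factorial / b ^ n * 2 ^ m, by positivity, fun r hr => ?_⟩
  have hr0 : 0 < r := by linarith
  have h1 : (b * r ^ β) ^ n / n.factorial ≤ Real.exp (b * r ^ β) :=
    Real.pow_div_factorial_le_exp _ (by positivity) n
  have h2 : r ^ m ≤ (r ^ β) ^ n := by
    rw [← Real.rpow_natCast, ← Real.rpow_natCast, ← Real.rpow_mul hr0.le]
    exact Real.rpow_le_rpow_of_exponent_le hr (by linarith)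
  have h3 : (1 + r) ^ m ≤ 2 ^ m * r ^ m := by
    rw [← mul_pow]
    gcongr
    linarith
  rw [neg_mul, Real.exp_neg, Real.rpow_neg (by positivity), Real.rpow_natCast,
    ← div_eq_mul_inv, inv_eq_one_div, div_le_div_iff₀ (Real.exp_pos _) (by positivity), one_mul]
  rw [mul_pow, div_le_iff₀ (by positivity)] at h1
  calc (1 + r) ^ m ≤ 2 ^ m * (r ^ β) ^ n := h3.trans (by gcongr)
    _ = 2 ^ m / b ^ n * (b ^ n * (r ^ β) ^ n) := by field_simp
    _ ≤ 2 ^ m / b ^ n * (Real.exp (b * r ^ β) * n.factorial) := by gcongr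
    _ = _ := by ring

/-- The jump kernel is integrable away from the origin. -/
theorem HKAssumptions.integrableOn_J (H : HKAssumptions d φ J a₁ α₁ C₀ a b β κ κ₀ κ₁ κ₂ δ)
    {ε : ℝ} (hε : 0 < ε) :
    IntegrableOn (fun z : EuclideanSpace ℝ (Fin d) => J ‖z‖) {z | ε < ‖z‖} := by
  obtain ⟨C, hC, hexp⟩ := exp_neg_mul_rpow_le H.hb H.β_pos (d + 1)
  have hJε := H.J_pos ε hε
  have ha : 0 < a := by linarith [H.ha]
  have hbound : Integrable (fun z : EuclideanSpace ℝ (Fin d) =>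
      (a * C + J ε * 2 ^ (d + 1)) * (1 + ‖z‖) ^ (-((d + 1 : ℕ) : ℝ))) := by
    refine (integrable_one_add_norm ?_).const_mul _
    simp
  have hmeas : MeasurableSet {z : EuclideanSpace ℝ (Fin d) | ε < ‖z‖} :=
    measurableSet_lt measurable_const measurable_norm
  refine Integrable.mono' hbound.integrableOn ?_ ?_
  · refine ContinuousOn.aestronglyMeasurable ?_ hmeas
    exact H.J_cont.comp continuous_norm.continuousOn fun z hz => hε.trans hz
  · refine (ae_restrict_iff' hmeas).2 (Eventually.of_forall fun z hz => ?_)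
    have hz0 : 0 < ‖z‖ := hε.trans hz
    rw [Real.norm_eq_abs, abs_of_pos (H.J_pos _ hz0)]
    have hpos : 0 < (1 + ‖z‖) ^ (-((d + 1 : ℕ) : ℝ)) := by positivity
    rcases le_or_gt ‖z‖ 1 with h1 | h1
    · have h2 : J ‖z‖ ≤ J ε := H.J_anti hε hz0 (le_of_lt hz)
      have h3 : 1 ≤ 2 ^ (d + 1) * (1 + ‖z‖) ^ (-((d + 1 : ℕ) : ℝ)) := by
        rw [Real.rpow_neg (by positivity), Real.rpow_natCast, ← div_eq_mul_inv,
          one_le_div (by positivity)]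
        gcongr
        linarith
      calc J ‖z‖ ≤ J ε * 1 := by linarith
        _ ≤ J ε * (2 ^ (d + 1) * (1 + ‖z‖) ^ (-((d + 1 : ℕ) : ℝ))) := by gcongr
        _ ≤ _ := by nlinarith [mul_pos (mul_pos ha hC) hpos]
    · calc J ‖z‖ ≤ a * Real.exp (-b * ‖z‖ ^ β) := H.hJ1_exp _ h1
        _ ≤ a * (C * (1 + ‖z‖) ^ (-((d + 1 : ℕ) : ℝ))) := by gcongr; exact hexp _ h1.le
        _ ≤ _ := by nlinarith [mul_pos (mul_pos hJε (pow_pos two_pos (d + 1))) hpos]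

theorem HKAssumptions.integrableOn_κJ (H : HKAssumptions d φ J a₁ α₁ C₀ a b β κ κ₀ κ₁ κ₂ δ)
    {ε : ℝ} (hε : 0 < ε) (x : EuclideanSpace ℝ (Fin d)) :
    IntegrableOn (fun z => κ x z * J ‖z‖) {z | ε < ‖z‖} := by
  refine (H.integrableOn_J hε).bdd_mul (c := κ₁)
    (H.κ_meas.comp (measurable_const.prodMk measurable_id)).aestronglyMeasurable
    (Eventually.of_forall fun z => ?_)
  rw [Real.norm_eq_abs, abs_of_nonneg (H.κ₀_pos.le.trans (H.κ_low x z))]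
  exact H.κ_up x z

/-- The truncated operator is given by a convergent integral on bounded continuous functions. -/
theorem HKAssumptions.integrableOn_Leps (H : HKAssumptions d φ J a₁ α₁ C₀ a b β κ κ₀ κ₁ κ₂ δ)
    {ε : ℝ} (hε : 0 < ε) {f : EuclideanSpace ℝ (Fin d) → ℝ} (hf : Continuous f)
    {B : ℝ} (hB : ∀ x, |f x| ≤ B) (x : EuclideanSpace ℝ (Fin d)) :
    IntegrableOn (fun z => (f (x + z) - f x) * (κ x z * J ‖z‖)) {z | ε < ‖z‖} := by
  refine (H.integrableOn_κJ hε x).bdd_mul (c := B + B)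
    (Continuous.aestronglyMeasurable (by fun_prop)) (Eventually.of_forall fun z => ?_)
  exact (norm_sub_le _ _).trans (add_le_add (hB _) (hB _))

theorem HKAssumptions.Leps_sub (H : HKAssumptions d φ J a₁ α₁ C₀ a b β κ κ₀ κ₁ κ₂ δ)
    {ε : ℝ} (hε : 0 < ε) {f g : EuclideanSpace ℝ (Fin d) → ℝ} (hf : Continuous f)
    (hg : Continuous g) {B B' : ℝ} (hB : ∀ x, |f x| ≤ B) (hB' : ∀ x, |g x| ≤ B')
    (x : EuclideanSpace ℝ (Fin d)) :
    Leps d κ J ε (fun x' => f x' - g x') x = Leps d κ J ε f x - Leps d κ J ε g x := by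
  rw [Leps, Leps, Leps,
    ← integral_sub (H.integrableOn_Leps hε hf hB x) (H.integrableOn_Leps hε hg hB' x)]
  exact integral_congr_ae (Eventually.of_forall fun z => by ring)

/-- Positive maximum principle for the truncated operator. -/
theorem HKAssumptions.Leps_nonpos (H : HKAssumptions d φ J a₁ α₁ C₀ a b β κ κ₀ κ₁ κ₂ δ)
    {ε : ℝ} (hε : 0 < ε) {f : EuclideanSpace ℝ (Fin d) → ℝ} {x : EuclideanSpace ℝ (Fin d)}
    (hf : ∀ x', f x' ≤ f x) : Leps d κ J ε f x ≤ 0 := by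
  refine setIntegral_nonpos (measurableSet_lt measurable_const measurable_norm) fun z hz => ?_
  refine mul_nonpos_of_nonpos_of_nonneg (sub_nonpos.2 (hf _)) (mul_nonneg ?_ ?_)
  · exact H.κ₀_pos.le.trans (H.κ_low x z)
  · exact (H.J_pos _ (hε.trans hz)).le

/-- Parabolic maximum principle for functions that are asymptotically nonpositive at infinity. -/
theorem HKAssumptions.maximum_principle
    (H : HKAssumptions d φ J a₁ α₁ C₀ a b β κ κ₀ κ₁ κ₂ δ)
    {w : ℝ → EuclideanSpace ℝ (Fin d) → ℝ} {T M : ℝ} (hT : 0 < T) (hM : 0 ≤ M)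
    (hcont : ContinuousOn (Function.uncurry w) (Ioi 0 ×ˢ univ))
    (hinf : ∀ η, 0 < η → ∃ R, ∀ t, 0 < t → t ≤ T → ∀ x, R ≤ ‖x‖ → w t x ≤ η)
    (hinit : ∀ η, 0 < η → ∃ t₀, 0 < t₀ ∧ ∀ t, 0 < t → t < t₀ → ∀ x, w t x ≤ M + η)
    (heq : ∀ t, 0 < t → ∀ x, ∃ L, Tendsto (fun ε => Leps d κ J ε (w t) x)
      (nhdsWithin 0 (Ioi 0)) (nhds L) ∧ HasDerivAt (fun s => w s x) L t)
    (x : EuclideanSpace ℝ (Fin d)) : w T x ≤ M := by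
  by_contra! hlt
  set η := (w T x - M) / 2 with hη
  have hηpos : 0 < η := by rw [hη]; linarith
  have hwη : w T x = M + 2 * η := by rw [hη]; ring
  obtain ⟨R, hR⟩ := hinf (η / 2) (by positivity)
  obtain ⟨t₀, ht₀, hinit⟩ := hinit (η / 2) (by positivity)
  set t₁ := min (t₀ / 2) T
  have ht₁ : 0 < t₁ := by positivity
  set K : Set (ℝ × EuclideanSpace ℝ (Fin d)) :=
    Icc t₁ T ×ˢ Metric.closedBall 0 (max R ‖x‖) with hK
  have hKc : IsCompact K := isCompact_Icc.prod (isCompact_closedBall _ _)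
  have hxK : (T, x) ∈ K := by
    refine ⟨⟨min_le_right _ _, le_rfl⟩, ?_⟩
    simp
  have hvc : ContinuousOn (fun q : ℝ × EuclideanSpace ℝ (Fin d) =>
      Function.uncurry w q - η / T * q.1) K := by
    refine (hcont.mono ?_).sub (by fun_prop)
    exact prod_mono (fun t ht => ht₁.trans_le ht.1) (subset_univ _)
  obtain ⟨⟨ts, xs⟩, hsK, hmax⟩ := hKc.exists_isMaxOn ⟨_, hxK⟩ hvc
  have hts : 0 < ts := ht₁.trans_le hsK.1.1
  have hηT : 0 < η / T := by positivity
  have hstar : M + η ≤ w ts xs - η / T * ts := by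
    have := hmax hxK
    simp only [mem_ofPred_eq, Function.uncurry_apply_pair] at this
    have h2 : η / T * T = η := by field_simp
    linarith
  have hglob : ∀ t, 0 < t → t ≤ T → ∀ x', w t x' - η / T * t ≤ w ts xs - η / T * ts := by
    intro t ht htT x'
    have hpos : 0 < η / T * t := by positivity
    rcases lt_or_ge t t₁ with h | h
    · have := hinit t ht (by linarith [min_le_left (t₀ / 2) T]) x'
      linarith
    · rcases le_or_gt ‖x'‖ (max R ‖x‖) with h' | h'
      · exact hmax (show (t, x') ∈ K from ⟨⟨h, htT⟩, by simpa using h'⟩)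
      · have := hR t ht htT x' ((le_max_left _ _).trans h'.le)
        linarith
  obtain ⟨L, hL, hder⟩ := heq ts hts xs
  have hLnonpos : L ≤ 0 := by
    refine le_of_tendsto hL ?_
    filter_upwards [self_mem_nhdsWithin] with ε hε
    refine H.Leps_nonpos hε fun x' => ?_
    linarith [hglob ts hts hsK.1.2 x']
  have hLge : η / T ≤ L := by
    have h1 := hder.hasDerivWithinAt (s := Iio ts)
    rw [hasDerivWithinAt_iff_tendsto_slope' (by simp)] at h1
    refine ge_of_tendsto h1 ?_
    have hmem : Ioo 0 ts ∈ nhdsWithin ts (Iio ts) := Ioo_mem_nhdsLT hts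
    filter_upwards [hmem] with t ht
    have := hglob t ht.1 (ht.2.le.trans hsK.1.2) xs
    rw [slope_comm, slope_def_field, le_div_iff₀ (by linarith [ht.2])]
    linarith
  linarith

theorem GoodHeatKernel.exists_Leps_bound (hp : GoodHeatKernel d φ J b β Φinv κ p)
    (H : HKAssumptions d φ J a₁ α₁ C₀ a b β κ κ₀ κ₁ κ₂ δ) (HΦ : PhiInvSpec φ Φinv)
    {t₁ : ℝ} (ht₁ : 0 < t₁) (T : ℝ) :
    ∃ M, 0 < M ∧ ∀ t, t₁ ≤ t → t ≤ T → ∀ x y, x ≠ y → ∀ ε, 0 < ε → ε ≤ 1 →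
      |Leps d κ J ε (fun x' => p t x' y) x| ≤ M := by
  obtain ⟨c, hc, hfrac⟩ := hp.frac (max 1 T) (le_max_left _ _)
  obtain ⟨ρ, hρ, hρ'⟩ := H.exists_le_Φinv HΦ ht₁
  refine ⟨c * (1 / (t₁ * ρ ^ d)), by positivity, fun t ht htT x y hxy ε hε hε1 => ?_⟩
  refine (hfrac ε hε hε1 t (ht₁.trans_le ht) (htT.trans (le_max_right _ _)) x y hxy).trans ?_
  refine mul_le_mul_of_nonneg_left ?_ hc.le
  rw [Gtil, if_neg (sub_ne_zero.2 hxy)]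
  refine (min_le_left _ _).trans ?_
  have := hρ' t ht
  have ht0 : 0 < t := ht₁.trans_le ht
  gcongr

theorem GoodHeatKernel.exists_hasDerivAt_le (hp : GoodHeatKernel d φ J b β Φinv κ p)
    {t M : ℝ} (ht : 0 < t) {x y : EuclideanSpace ℝ (Fin d)} (hxy : x ≠ y)
    (hM : ∀ ε, 0 < ε → ε ≤ 1 → |Leps d κ J ε (fun x' => p t x' y) x| ≤ M) :
    ∃ L, HasDerivAt (fun s => p s x y) L t ∧ |L| ≤ M := by
  obtain ⟨L, hL, hder⟩ := hp.eqn t ht x y hxy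
  refine ⟨L, hder, le_of_tendsto hL.abs ?_⟩
  filter_upwards [Ioc_mem_nhdsGT (zero_lt_one (α := ℝ))] with ε hε
  exact hM ε hε.1 hε.2

theorem GoodHeatKernel.abs_sub_le (hp : GoodHeatKernel d φ J b β Φinv κ p)
    {t₁ t₂ M : ℝ} (ht₁ : 0 < t₁) (ht : t₁ ≤ t₂) {x y : EuclideanSpace ℝ (Fin d)} (hxy : x ≠ y)
    (hM : ∀ t, t₁ ≤ t → t ≤ t₂ → ∀ ε, 0 < ε → ε ≤ 1 →
      |Leps d κ J ε (fun x' => p t x' y) x| ≤ M) :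
    |p t₂ x y - p t₁ x y| ≤ M * (t₂ - t₁) := by
  have hex : ∀ t ∈ Icc t₁ t₂, ∃ L, HasDerivAt (fun s => p s x y) L t ∧ |L| ≤ M := fun t ht' =>
    hp.exists_hasDerivAt_le (ht₁.trans_le ht'.1) hxy (hM t ht'.1 ht'.2)
  choose! L hL hLM using hex
  have := (convex_Icc t₁ t₂).norm_image_sub_le_of_norm_hasDerivWithin_le
    (fun t ht' => (hL t ht').hasDerivWithinAt) hLM (left_mem_Icc.2 ht) (right_mem_Icc.2 ht)
  rwa [Real.norm_eq_abs, Real.norm_eq_abs, abs_of_nonneg (sub_nonneg.2 ht)] at this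

theorem GoodHeatKernel.continuous_right (hp : GoodHeatKernel d φ J b β Φinv κ p)
    {t : ℝ} (ht : 0 < t) :
    Continuous fun q : EuclideanSpace ℝ (Fin d) × EuclideanSpace ℝ (Fin d) => p t q.1 q.2 :=
  hp.cont.comp_continuous (f := fun q : EuclideanSpace ℝ (Fin d) × EuclideanSpace ℝ (Fin d) =>
    (t, q.1, q.2)) (by fun_prop) fun _ => ⟨ht, mem_univ _⟩

/-- A one-sided version of the off-diagonal smallness of the kernel; `σ` is a sign. -/
theorem GoodHeatKernel.sign_mul_le (hp : GoodHeatKernel d φ J b β Φinv κ p)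
    {t M ρ σ : ℝ} (ht : 0 < t) (hρ : 0 < ρ) (hσ : |σ| = 1)
    {x y₀ : EuclideanSpace ℝ (Fin d)} (hx : x ∉ Metric.ball y₀ ρ)
    (hM : ∀ y ∈ Metric.ball y₀ ρ, ∀ r, 0 < r → r ≤ t → ∀ ε, 0 < ε → ε ≤ 1 →
      |Leps d κ J ε (fun x' => p r x' y) x| ≤ M) : σ * p t x y₀ ≤ M * t := by
  by_contra! hlt
  obtain ⟨η, hη, hlt⟩ : ∃ η > 0, M * t + η < σ * p t x y₀ :=
    ⟨(σ * p t x y₀ - M * t) / 2, by linarith, by linarith⟩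
  have hc : Continuous fun y => σ * p t x y :=
    continuous_const.mul ((hp.continuous_right ht).comp (by fun_prop : Continuous fun y => (x, y)))
  obtain ⟨r, hr, hball⟩ := Metric.mem_nhds_iff.1
    (hc.continuousAt.eventually (lt_mem_nhds hlt))
  have hr' : 0 < min r ρ := lt_min hr hρ
  set f : EuclideanSpace ℝ (Fin d) → ℝ := fun y => max 0 (min r ρ - dist y y₀) with hf
  have hfc : Continuous f := by fun_prop
  have hf0 : ∀ y, 0 ≤ f y := fun y => le_max_left _ _
  have hfout : ∀ y, y ∉ Metric.ball y₀ (min r ρ) → f y = 0 := by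
    intro y hy
    rw [Metric.mem_ball, not_lt] at hy
    exact max_eq_left (by linarith)
  have hfs : HasCompactSupport f := by
    refine HasCompactSupport.intro (isCompact_closedBall y₀ (min r ρ)) fun y hy => hfout y ?_
    exact fun h => hy (Metric.ball_subset_closedBall h)
  have hfint : 0 < ∫ y, f y := by
    refine hfc.integral_pos_of_hasCompactSupport_nonneg_nonzero hfs hf0 (x := y₀) ?_
    simp only [hf, dist_self, sub_zero]
    rw [max_eq_right hr'.le]
    exact hr'.ne'
  have hfx : f x = 0 := hfout x fun h => hx (Metric.ball_subset_ball (min_le_right _ _) h)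
  obtain ⟨B, hB⟩ := hfc.bounded_above_of_compact_support hfs
  obtain ⟨t₀, ht₀, happ⟩ := hp.approx f ⟨B, hB⟩
    (hfs.uniformContinuous_of_continuous hfc) (η * (∫ y, f y) / 2) (half_pos (mul_pos hη hfint))
  set s := min (t₀ / 2) t
  have hs : 0 < s := by positivity
  have happ := happ s hs ((min_le_left _ _).trans_lt (by linarith)) x
  rw [hfx, sub_zero] at happ
  have hsc : Continuous fun y => p s x y :=
    (hp.continuous_right hs).comp (by fun_prop : Continuous fun y => (x, y))
  have hle : η * ∫ y, f y ≤ σ * ∫ y, p s x y * f y := by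
    rw [← integral_const_mul, ← integral_const_mul]
    refine integral_mono ((hfc.integrable_of_hasCompactSupport hfs).const_mul _)
      (((hsc.mul hfc).integrable_of_hasCompactSupport hfs.mul_left).const_mul _) fun y => ?_
    by_cases hy : y ∈ Metric.ball y₀ (min r ρ)
    · have hyρ : y ∈ Metric.ball y₀ ρ := Metric.ball_subset_ball (min_le_right _ _) hy
      have hxy : x ≠ y := fun h => hx (h ▸ hyρ)
      have h1 : M * t + η < σ * p t x y :=
        hball (Metric.ball_subset_ball (min_le_left _ _) hy)
      have h2 := hp.abs_sub_le hs (min_le_right _ _) hxy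
        fun u hu hut => hM y hyρ u (hs.trans_le hu) hut
      have hM0 : 0 ≤ M := (abs_nonneg _).trans (hM y hyρ t ht le_rfl 1 one_pos le_rfl)
      have h3 : σ * (p t x y - p s x y) ≤ M * (t - s) := by
        refine (le_abs_self _).trans ?_
        rwa [abs_mul, hσ, one_mul]
      have h4 : η ≤ σ * p s x y := by nlinarith [mul_nonneg hM0 hs.le]
      calc η * f y ≤ (σ * p s x y) * f y := mul_le_mul_of_nonneg_right h4 (hf0 y)
        _ = σ * (p s x y * f y) := by ring
    · simp [hfout y hy]
  have hle2 : σ * ∫ y, p s x y * f y ≤ η * (∫ y, f y) / 2 := by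
    refine (le_abs_self _).trans ?_
    rwa [abs_mul, hσ, one_mul]
  linarith [mul_pos hη hfint]

theorem Phi_of_one_lt {r : ℝ} (hr : 1 < r) :
    1 / Phi φ r = 2 * (∫ s in Ioo (0:ℝ) 1, s / φ s) / r ^ 2 := by
  rw [Phi, if_neg (not_le.2 hr)]
  simp only [one_div, mul_inv, inv_inv]
  ring

/-- Two-sided polynomial decay of the kernel away from the diagonal. -/
theorem GoodHeatKernel.exists_decay (hp : GoodHeatKernel d φ J b β Φinv κ p)
    (H : HKAssumptions d φ J a₁ α₁ C₀ a b β κ κ₀ κ₁ κ₂ δ) (T : ℝ) :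
    ∃ C, 0 ≤ C ∧ ∀ t, 0 < t → t ≤ T → ∀ x y, 2 < ‖x - y‖ →
      |p t x y| ≤ C / ‖x - y‖ ^ (d + 2) := by
  obtain ⟨c, hc, hfrac⟩ := hp.frac (max 1 T) (le_max_left _ _)
  set I := ∫ s in Ioo (0:ℝ) 1, s / φ s with hI
  have hI0 : 0 ≤ I := setIntegral_nonneg measurableSet_Ioo fun s hs =>
    div_nonneg hs.1.le (H.φ_pos hs.1 hs.2.le).le
  refine ⟨c * (2 * I) * 2 ^ (d + 2) * max 1 T, by positivity, fun t ht htT x y₀ hxy => ?_⟩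
  set M := c * (2 * I) * 2 ^ (d + 2) / ‖x - y₀‖ ^ (d + 2) with hM
  have hx0 : 0 < ‖x - y₀‖ := by linarith
  have hM0 : 0 ≤ M := by positivity
  have hxball : x ∉ Metric.ball y₀ (‖x - y₀‖ / 2) := by
    rw [Metric.mem_ball, dist_eq_norm]
    linarith
  have hbound : ∀ y ∈ Metric.ball y₀ (‖x - y₀‖ / 2), ∀ r, 0 < r → r ≤ t → ∀ ε, 0 < ε → ε ≤ 1 →
      |Leps d κ J ε (fun x' => p r x' y) x| ≤ M := by
    intro y hy r hr hrt ε hε hε1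
    have hne : x ≠ y := fun h => hxball (h ▸ hy)
    rw [Metric.mem_ball, dist_eq_norm] at hy
    have hhalf : ‖x - y₀‖ / 2 ≤ ‖x - y‖ := by
      have := norm_sub_le_norm_sub_add_norm_sub x y y₀
      linarith
    have h1 : 1 < ‖x - y‖ := by linarith
    refine (hfrac ε hε hε1 r hr ((hrt.trans htT).trans (le_max_right _ _)) x y hne).trans ?_
    rw [Gtil, if_neg (sub_ne_zero.2 hne)]
    calc c * min _ (1 / (‖x - y‖ ^ d * Phi φ ‖x - y‖))
        ≤ c * (1 / (‖x - y‖ ^ d * Phi φ ‖x - y‖)) := by gcongr; exact min_le_right _ _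
      _ = c * (1 / ‖x - y‖ ^ d * (1 / Phi φ ‖x - y‖)) := by rw [one_div_mul_one_div]
      _ = c * (2 * I) / ‖x - y‖ ^ (d + 2) := by
        rw [Phi_of_one_lt h1, ← hI, pow_add]
        field_simp
      _ ≤ c * (2 * I) / (‖x - y₀‖ / 2) ^ (d + 2) := by gcongr
      _ = M := by rw [hM, div_pow]; field_simp
  have hρ : 0 < ‖x - y₀‖ / 2 := by linarith
  have hplus := hp.sign_mul_le (σ := 1) ht hρ (by simp) hxball hbound
  have hminus := hp.sign_mul_le (σ := -1) ht hρ (by simp) hxball hbound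
  have habs : |p t x y₀| ≤ M * t := abs_le.2 ⟨by linarith, by linarith⟩
  calc |p t x y₀| ≤ M * max 1 T :=
        habs.trans (mul_le_mul_of_nonneg_left (htT.trans (le_max_right _ _)) hM0)
    _ = _ := by rw [hM]; ring

theorem GoodHeatKernel.integrable_right (hp : GoodHeatKernel d φ J b β Φinv κ p)
    (H : HKAssumptions d φ J a₁ α₁ C₀ a b β κ κ₀ κ₁ κ₂ δ) {t : ℝ} (ht : 0 < t)
    (x : EuclideanSpace ℝ (Fin d)) : Integrable (p t x) := by
  have hc : Continuous (p t x) :=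
    (hp.continuous_right ht).comp (by fun_prop : Continuous fun y => (x, y))
  obtain ⟨C, hC, hdecay⟩ := hp.exists_decay H t
  obtain ⟨B, hB⟩ := (isCompact_closedBall x 2).exists_bound_of_continuousOn hc.continuousOn
  have hg : Integrable (fun y : EuclideanSpace ℝ (Fin d) =>
      (C * 2 ^ (d + 2)) * (1 + ‖x - y‖) ^ (-((d + 2 : ℕ) : ℝ))) :=
    ((integrable_one_add_norm (by simp)).const_mul _).comp_sub_left x
  have hind : Integrable ((Metric.closedBall x 2).indicator (p t x)) :=
    (hc.continuousOn.integrableOn_compact (isCompact_closedBall x 2)).integrable_indicator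
      Metric.isClosed_closedBall.measurableSet
  refine Integrable.mono' (hind.norm.add hg) hc.aestronglyMeasurable
    (Eventually.of_forall fun y => ?_)
  have hpos : 0 ≤ (C * 2 ^ (d + 2)) * (1 + ‖x - y‖) ^ (-((d + 2 : ℕ) : ℝ)) := by positivity
  by_cases hy : y ∈ Metric.closedBall x 2
  · simpa [indicator_of_mem hy] using hpos
  · have hxy : 2 < ‖x - y‖ := by
      rwa [Metric.mem_closedBall, dist_comm, dist_eq_norm, not_le] at hy
    simp only [Pi.add_apply, indicator_of_notMem hy, norm_zero, zero_add]
    refine (hdecay t ht le_rfl x y hxy).trans ?_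
    rw [Real.rpow_neg (by positivity), Real.rpow_natCast, ← div_eq_mul_inv,
      div_le_div_iff₀ (by positivity) (by positivity), mul_assoc, ← mul_pow]
    gcongr
    linarith

/-- The kernel is bounded when its last variable stays in a compact set. -/
theorem GoodHeatKernel.exists_bound (hp : GoodHeatKernel d φ J b β Φinv κ p)
    (H : HKAssumptions d φ J a₁ α₁ C₀ a b β κ κ₀ κ₁ κ₂ δ) {t : ℝ} (ht : 0 < t) (R : ℝ) :
    ∃ B, 0 ≤ B ∧ ∀ x y, ‖y‖ ≤ R → |p t x y| ≤ B := by
  obtain ⟨C, hC, hdecay⟩ := hp.exists_decay H t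
  obtain ⟨B, hB⟩ := ((isCompact_closedBall (0 : EuclideanSpace ℝ (Fin d)) (R + 2)).prod
    (isCompact_closedBall (0 : EuclideanSpace ℝ (Fin d)) R)).exists_bound_of_continuousOn
    (hp.continuous_right ht).continuousOn
  refine ⟨max C B, hC.trans (le_max_left _ _), fun x y hy => ?_⟩
  by_cases hx : ‖x‖ ≤ R + 2
  · exact (hB (x, y) ⟨by simpa using hx, by simpa using hy⟩).trans (le_max_right _ _)
  · have hxy : 2 < ‖x - y‖ := by linarith [norm_sub_norm_le x y]
    refine (hdecay t ht le_rfl x y hxy).trans ((div_le_self hC ?_).trans (le_max_left _ _))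
    exact one_le_pow₀ (by linarith)

variable (p) in
/-- The operator with integral kernel `p t`. -/
noncomputable def heatOp (f : EuclideanSpace ℝ (Fin d) → ℝ) (t : ℝ)
    (x : EuclideanSpace ℝ (Fin d)) : ℝ :=
  ∫ y, p t x y * f y

variable {f : EuclideanSpace ℝ (Fin d) → ℝ}

theorem HasCompactSupport.exists_eq_zero_of_lt_norm (hfs : HasCompactSupport f) :
    ∃ R, 0 ≤ R ∧ ∀ y, R < ‖y‖ → f y = 0 := by
  obtain ⟨R, hR⟩ := hfs.isBounded.subset_closedBall 0
  refine ⟨max R 0, le_max_right _ _, fun y hy => ?_⟩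
  by_contra h
  have := hR (subset_tsupport f h)
  rw [mem_closedBall_zero_iff] at this
  exact absurd (this.trans (le_max_left _ _)) (not_le.2 hy)

theorem GoodHeatKernel.integrable_mul (hp : GoodHeatKernel d φ J b β Φinv κ p)
    (hf : Continuous f) (hfs : HasCompactSupport f) {t : ℝ} (ht : 0 < t)
    (x : EuclideanSpace ℝ (Fin d)) : Integrable fun y => p t x y * f y :=
  (((hp.continuous_right ht).comp (by fun_prop : Continuous fun y => (x, y))).mul
    hf).integrable_of_hasCompactSupport (μ := volume) hfs.mul_left

theorem GoodHeatKernel.continuousOn_heatOp (hp : GoodHeatKernel d φ J b β Φinv κ p)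
    (hf : Continuous f) (hfs : HasCompactSupport f) :
    ContinuousOn (Function.uncurry (heatOp p f)) (Ioi 0 ×ˢ univ) := by
  refine continuousOn_integral_of_compact_support
    (f := fun (q : ℝ × EuclideanSpace ℝ (Fin d)) y => p q.1 q.2 y * f y) (k := tsupport f) hfs
    ?_ fun q y _ hy => by simp [image_eq_zero_of_notMem_tsupport hy]
  refine ContinuousOn.mul ?_ (by fun_prop)
  exact hp.cont.comp
    (f := fun q : (ℝ × EuclideanSpace ℝ (Fin d)) × EuclideanSpace ℝ (Fin d) =>
      (q.1.1, q.1.2, q.2)) (by fun_prop) fun q hq => ⟨hq.1.1, mem_univ _⟩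

theorem GoodHeatKernel.continuous_heatOp (hp : GoodHeatKernel d φ J b β Φinv κ p)
    (hf : Continuous f) (hfs : HasCompactSupport f) {t : ℝ} (ht : 0 < t) :
    Continuous (heatOp p f t) :=
  (hp.continuousOn_heatOp hf hfs).comp_continuous (f := fun x => (t, x)) (by fun_prop)
    fun _ => ⟨ht, mem_univ _⟩

theorem GoodHeatKernel.exists_bound_heatOp (hp : GoodHeatKernel d φ J b β Φinv κ p)
    (H : HKAssumptions d φ J a₁ α₁ C₀ a b β κ κ₀ κ₁ κ₂ δ)
    (hf : Continuous f) (hfs : HasCompactSupport f) {t : ℝ} (ht : 0 < t) :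
    ∃ B, ∀ x, |heatOp p f t x| ≤ B := by
  obtain ⟨R, -, hR⟩ := hfs.exists_eq_zero_of_lt_norm
  obtain ⟨B, hB, hpB⟩ := hp.exists_bound H ht R
  refine ⟨∫ y, B * |f y|, fun x => ?_⟩
  rw [← Real.norm_eq_abs, heatOp]
  refine norm_integral_le_of_norm_le
    ((hf.integrable_of_hasCompactSupport (μ := volume) hfs).abs.const_mul B)
    (Eventually.of_forall fun y => ?_)
  rw [Real.norm_eq_abs, abs_mul]
  rcases le_or_gt ‖y‖ R with h | h
  · exact mul_le_mul_of_nonneg_right (hpB x y h) (abs_nonneg _)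
  · simp [hR y h]

theorem GoodHeatKernel.heatOp_tendsto_zero (hp : GoodHeatKernel d φ J b β Φinv κ p)
    (H : HKAssumptions d φ J a₁ α₁ C₀ a b β κ κ₀ κ₁ κ₂ δ)
    (hf : Continuous f) (hfs : HasCompactSupport f) (T : ℝ) {η : ℝ} (hη : 0 < η) :
    ∃ R, ∀ t, 0 < t → t ≤ T → ∀ x, R ≤ ‖x‖ → |heatOp p f t x| ≤ η := by
  obtain ⟨R, hR0, hR⟩ := hfs.exists_eq_zero_of_lt_norm
  obtain ⟨C, hC, hdecay⟩ := hp.exists_decay H T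
  have hfi := (hf.integrable_of_hasCompactSupport (μ := volume) hfs).abs
  have hI : 0 ≤ ∫ y, |f y| := integral_nonneg fun y => abs_nonneg _
  refine ⟨R + 3 + C * (∫ y, |f y|) / η, fun t ht htT x hx => ?_⟩
  set r := 3 + C * (∫ y, |f y|) / η with hr
  have hr3 : 3 ≤ r := by
    have : 0 ≤ C * (∫ y, |f y|) / η := by positivity
    linarith
  have hle : |heatOp p f t x| ≤ ∫ y, C / r * |f y| := by
    rw [← Real.norm_eq_abs, heatOp]
    refine norm_integral_le_of_norm_le (hfi.const_mul _) (Eventually.of_forall fun y => ?_)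
    rw [Real.norm_eq_abs, abs_mul]
    rcases le_or_gt ‖y‖ R with h | h
    · refine mul_le_mul_of_nonneg_right ?_ (abs_nonneg _)
      have hxy : r ≤ ‖x - y‖ := by linarith [norm_sub_norm_le x y]
      refine (hdecay t ht htT x y (by linarith)).trans ?_
      have h1 : r ≤ ‖x - y‖ ^ (d + 2) :=
        hxy.trans (le_self_pow₀ (by linarith) (by omega))
      gcongr
    · simp [hR y h]
  refine hle.trans ?_
  rw [integral_const_mul, div_mul_eq_mul_div, div_le_iff₀ (by linarith)]
  have : η * r = η * 3 + C * ∫ y, |f y| := by rw [hr]; field_simp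
  linarith

theorem GoodHeatKernel.integrable_Leps_prod (hp : GoodHeatKernel d φ J b β Φinv κ p)
    (H : HKAssumptions d φ J a₁ α₁ C₀ a b β κ κ₀ κ₁ κ₂ δ)
    (hf : Continuous f) (hfs : HasCompactSupport f) {t : ℝ} (ht : 0 < t)
    {ε : ℝ} (hε : 0 < ε) (x : EuclideanSpace ℝ (Fin d)) :
    Integrable (Function.uncurry fun z y => (p t (x + z) y - p t x y) * (κ x z * J ‖z‖) * f y)
      ((volume.restrict {z : EuclideanSpace ℝ (Fin d) | ε < ‖z‖}).prod volume) := by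
  obtain ⟨R, -, hR⟩ := hfs.exists_eq_zero_of_lt_norm
  obtain ⟨B, hB, hpB⟩ := hp.exists_bound H ht R
  have hprod := (H.integrableOn_κJ hε x).mul_prod
    (hf.integrable_of_hasCompactSupport (μ := volume) hfs)
  have hcont : Continuous fun q : EuclideanSpace ℝ (Fin d) × EuclideanSpace ℝ (Fin d) =>
      p t (x + q.1) q.2 - p t x q.2 :=
    ((hp.continuous_right ht).comp
      (by fun_prop : Continuous fun q : EuclideanSpace ℝ (Fin d) × EuclideanSpace ℝ (Fin d) =>
        (x + q.1, q.2))).sub ((hp.continuous_right ht).comp (by fun_prop :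
        Continuous fun q : EuclideanSpace ℝ (Fin d) × EuclideanSpace ℝ (Fin d) => (x, q.2)))
  refine Integrable.mono' (hprod.norm.const_mul (B + B)) ?_ (Eventually.of_forall ?_)
  · refine (hcont.aestronglyMeasurable.mul hprod.aestronglyMeasurable).congr
      (Eventually.of_forall fun q => ?_)
    simp only [Pi.mul_apply, Function.uncurry]
    ring
  · rintro ⟨z, y⟩
    simp only [Function.uncurry_apply_pair]
    rw [mul_assoc, norm_mul]
    rcases le_or_gt ‖y‖ R with h | h
    · exact mul_le_mul_of_nonneg_right
        ((norm_sub_le _ _).trans (add_le_add (hpB _ _ h) (hpB _ _ h))) (norm_nonneg _)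
    · simp [hR y h]

theorem GoodHeatKernel.integrable_Leps_mul (hp : GoodHeatKernel d φ J b β Φinv κ p)
    (H : HKAssumptions d φ J a₁ α₁ C₀ a b β κ κ₀ κ₁ κ₂ δ)
    (hf : Continuous f) (hfs : HasCompactSupport f) {t : ℝ} (ht : 0 < t)
    {ε : ℝ} (hε : 0 < ε) (x : EuclideanSpace ℝ (Fin d)) :
    Integrable fun y => Leps d κ J ε (fun x' => p t x' y) x * f y := by
  refine (hp.integrable_Leps_prod H hf hfs ht hε x).integral_prod_right.congr
    (Eventually.of_forall fun y => ?_)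
  simp only [Function.uncurry_apply_pair, Leps]
  rw [integral_mul_const]

theorem GoodHeatKernel.Leps_heatOp (hp : GoodHeatKernel d φ J b β Φinv κ p)
    (H : HKAssumptions d φ J a₁ α₁ C₀ a b β κ κ₀ κ₁ κ₂ δ)
    (hf : Continuous f) (hfs : HasCompactSupport f) {t : ℝ} (ht : 0 < t)
    {ε : ℝ} (hε : 0 < ε) (x : EuclideanSpace ℝ (Fin d)) :
    Leps d κ J ε (heatOp p f t) x = ∫ y, Leps d κ J ε (fun x' => p t x' y) x * f y := by
  have hswap := integral_integral_swap (hp.integrable_Leps_prod H hf hfs ht hε x)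
  simp only [integral_mul_const] at hswap
  simp only [Leps]
  rw [← hswap]
  refine integral_congr_ae (Eventually.of_forall fun z => ?_)
  simp only [heatOp]
  rw [← integral_sub (hp.integrable_mul hf hfs ht _) (hp.integrable_mul hf hfs ht _),
    ← integral_mul_const]
  exact integral_congr_ae (Eventually.of_forall fun y => by ring)

theorem HKAssumptions.ae_ne (H : HKAssumptions d φ J a₁ α₁ C₀ a b β κ κ₀ κ₁ κ₂ δ)
    (x : EuclideanSpace ℝ (Fin d)) : ∀ᵐ y, x ≠ y := by
  have : Nonempty (Fin d) := ⟨⟨0, H.hd⟩⟩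
  have : Nontrivial (EuclideanSpace ℝ (Fin d)) := inferInstance
  have h0 : volume ({x} : Set (EuclideanSpace ℝ (Fin d))) = 0 := measure_singleton x
  filter_upwards [compl_mem_ae_iff.2 h0] with y hy h
  exact hy h.symm

/-- `heatOp p f` is a classical solution of the heat equation, on the diagonal as well. -/
theorem GoodHeatKernel.heatOp_eqn (hp : GoodHeatKernel d φ J b β Φinv κ p)
    (H : HKAssumptions d φ J a₁ α₁ C₀ a b β κ κ₀ κ₁ κ₂ δ) (HΦ : PhiInvSpec φ Φinv)
    (hf : Continuous f) (hfs : HasCompactSupport f) {t : ℝ} (ht : 0 < t)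
    (x : EuclideanSpace ℝ (Fin d)) :
    ∃ L, Tendsto (fun ε => Leps d κ J ε (heatOp p f t) x) (nhdsWithin 0 (Ioi 0)) (nhds L) ∧
      HasDerivAt (fun s => heatOp p f s x) L t := by
  obtain ⟨M, hM, hMb⟩ := hp.exists_Leps_bound H HΦ (half_pos ht) (2 * t)
  have hfi := (hf.integrable_of_hasCompactSupport (μ := volume) hfs).norm
  have hlim : ∀ᵐ y, Tendsto (fun ε => Leps d κ J ε (fun x' => p t x' y) x * f y)
      (nhdsWithin 0 (Ioi 0)) (nhds (deriv (fun s => p s x y) t * f y)) := by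
    filter_upwards [H.ae_ne x] with y hxy
    obtain ⟨L, hL, hder⟩ := hp.eqn t ht x y hxy
    rw [hder.deriv]
    exact hL.mul_const _
  refine ⟨∫ y, deriv (fun s => p s x y) t * f y, ?_, ?_⟩
  · have hmem : Ioc (0:ℝ) 1 ∈ nhdsWithin (0:ℝ) (Ioi 0) := Ioc_mem_nhdsGT zero_lt_one
    refine Tendsto.congr' (f₁ := fun ε =>
      ∫ y, Leps d κ J ε (fun x' => p t x' y) x * f y) ?_ ?_
    · filter_upwards [hmem] with ε hε
      exact (hp.Leps_heatOp H hf hfs ht hε.1 x).symm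
    · refine tendsto_integral_filter_of_dominated_convergence (fun y => M * ‖f y‖) ?_ ?_
        (hfi.const_mul M) hlim
      · filter_upwards [hmem] with ε hε
        exact (hp.integrable_Leps_mul H hf hfs ht hε.1 x).aestronglyMeasurable
      · filter_upwards [hmem] with ε hε
        filter_upwards [H.ae_ne x] with y hxy
        rw [norm_mul]
        exact mul_le_mul_of_nonneg_right
          (hMb t (by linarith) (by linarith) x y hxy ε hε.1 hε.2) (norm_nonneg _)
  · have hseq : Tendsto (fun n : ℕ => 1 / ((n : ℝ) + 1)) atTop (nhdsWithin 0 (Ioi 0)) :=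
      tendsto_nhdsWithin_iff.2 ⟨tendsto_one_div_add_atTop_nhds_zero_nat,
        Eventually.of_forall fun n => mem_Ioi.2 (by positivity)⟩
    have hmeas : AEStronglyMeasurable fun y => deriv (fun s => p s x y) t * f y := by
      refine aestronglyMeasurable_of_tendsto_ae atTop
        (f := fun (n : ℕ) y => Leps d κ J (1 / ((n : ℝ) + 1)) (fun x' => p t x' y) x * f y)
        (fun n => (hp.integrable_Leps_mul H hf hfs ht (by positivity) x).aestronglyMeasurable) ?_
      filter_upwards [hlim] with y hy
      exact hy.comp hseq
    have hder : ∀ᵐ y, ∀ s ∈ Ioo (t / 2) (2 * t), ∃ L,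
        HasDerivAt (fun s => p s x y) L s ∧ |L| ≤ M := by
      filter_upwards [H.ae_ne x] with y hxy s hs
      exact hp.exists_hasDerivAt_le (by linarith [hs.1]) hxy
        (hMb s hs.1.le hs.2.le x y hxy)
    have hnhds : Ioo (t / 2) (2 * t) ∈ nhds t := Ioo_mem_nhds (by linarith) (by linarith)
    refine (hasDerivAt_integral_of_dominated_loc_of_deriv_le (F := fun s y => p s x y * f y)
      (F' := fun s y => deriv (fun s => p s x y) s * f y) (bound := fun y => M * ‖f y‖)
      hnhds ?_ (hp.integrable_mul hf hfs ht x) hmeas ?_ (hfi.const_mul M) ?_).2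
    · filter_upwards [lt_mem_nhds ht] with s hs
      exact (hp.integrable_mul hf hfs hs x).aestronglyMeasurable
    · filter_upwards [hder] with y hy s hs
      obtain ⟨L, hL, hLM⟩ := hy s hs
      rw [hL.deriv, norm_mul]
      exact mul_le_mul_of_nonneg_right hLM (norm_nonneg _)
    · filter_upwards [hder] with y hy s hs
      obtain ⟨L, hL, -⟩ := hy s hs
      rw [hL.deriv]
      exact hL.mul_const _

theorem GoodHeatKernel.exists_lipschitz_heatOp (hp : GoodHeatKernel d φ J b β Φinv κ p)
    (H : HKAssumptions d φ J a₁ α₁ C₀ a b β κ κ₀ κ₁ κ₂ δ) (HΦ : PhiInvSpec φ Φinv)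
    (hf : Continuous f) (hfs : HasCompactSupport f) {s : ℝ} (hs : 0 < s) :
    ∃ C, 0 < C ∧ ∀ t, 0 < t → t ≤ 1 → ∀ x, |heatOp p f (t + s) x - heatOp p f s x| ≤ C * t := by
  obtain ⟨M, hM, hMb⟩ := hp.exists_Leps_bound H HΦ hs (1 + s)
  have hfi := (hf.integrable_of_hasCompactSupport (μ := volume) hfs).norm
  have hI : 0 ≤ ∫ y, ‖f y‖ := integral_nonneg fun y => norm_nonneg _
  refine ⟨M * (∫ y, ‖f y‖) + 1, by positivity, fun t ht ht1 x => ?_⟩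
  have hle : |heatOp p f (t + s) x - heatOp p f s x| ≤ ∫ y, M * t * ‖f y‖ := by
    rw [heatOp, heatOp, ← integral_sub (hp.integrable_mul hf hfs (by positivity) _)
      (hp.integrable_mul hf hfs hs _)]
    rw [← Real.norm_eq_abs]
    refine norm_integral_le_of_norm_le (hfi.const_mul _) ?_
    filter_upwards [H.ae_ne x] with y hxy
    rw [← sub_mul, norm_mul]
    refine mul_le_mul_of_nonneg_right ?_ (norm_nonneg _)
    have := hp.abs_sub_le hs (by linarith : s ≤ t + s) hxy
      fun r hr hrt => hMb r hr (by linarith) x y hxy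
    rwa [add_sub_cancel_right] at this
  rw [integral_const_mul] at hle
  linarith

/-- Comparison of two time-shifted solutions of the heat equation. -/
theorem GoodHeatKernel.heatOp_sub_heatOp_le (hp : GoodHeatKernel d φ J b β Φinv κ p)
    (H : HKAssumptions d φ J a₁ α₁ C₀ a b β κ κ₀ κ₁ κ₂ δ) (HΦ : PhiInvSpec φ Φinv)
    {f₁ f₂ : EuclideanSpace ℝ (Fin d) → ℝ} (hf₁ : Continuous f₁) (hfs₁ : HasCompactSupport f₁)
    (hf₂ : Continuous f₂) (hfs₂ : HasCompactSupport f₂) {s₁ s₂ M t : ℝ} (ht : 0 < t)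
    (hs₁ : 0 ≤ s₁) (hs₂ : 0 ≤ s₂) (hM : 0 ≤ M)
    (hinit : ∀ η, 0 < η → ∃ t₀, 0 < t₀ ∧ ∀ t, 0 < t → t < t₀ → ∀ x,
      heatOp p f₁ (t + s₁) x - heatOp p f₂ (t + s₂) x ≤ M + η)
    (x : EuclideanSpace ℝ (Fin d)) :
    heatOp p f₁ (t + s₁) x - heatOp p f₂ (t + s₂) x ≤ M := by
  refine H.maximum_principle (w := fun t x => heatOp p f₁ (t + s₁) x - heatOp p f₂ (t + s₂) x)
    ht hM ?_ ?_ hinit ?_ x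
  · refine ((hp.continuousOn_heatOp hf₁ hfs₁).comp
      (f := fun q : ℝ × EuclideanSpace ℝ (Fin d) => (q.1 + s₁, q.2)) (by fun_prop) ?_).sub
      ((hp.continuousOn_heatOp hf₂ hfs₂).comp
      (f := fun q : ℝ × EuclideanSpace ℝ (Fin d) => (q.1 + s₂, q.2)) (by fun_prop) ?_)
    · exact fun q hq => ⟨add_pos_of_pos_of_nonneg hq.1 hs₁, mem_univ _⟩
    · exact fun q hq => ⟨add_pos_of_pos_of_nonneg hq.1 hs₂, mem_univ _⟩
  · intro η hη
    obtain ⟨R₁, hR₁⟩ := hp.heatOp_tendsto_zero H hf₁ hfs₁ (t + s₁) (half_pos hη)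
    obtain ⟨R₂, hR₂⟩ := hp.heatOp_tendsto_zero H hf₂ hfs₂ (t + s₂) (half_pos hη)
    refine ⟨max R₁ R₂, fun r hr hrt x hx => ?_⟩
    have h₁ := hR₁ (r + s₁) (by linarith) (by linarith) x ((le_max_left _ _).trans hx)
    have h₂ := hR₂ (r + s₂) (by linarith) (by linarith) x ((le_max_right _ _).trans hx)
    rw [abs_le] at h₁ h₂
    linarith [h₁.2, h₂.1]
  · intro r hr x
    have hr₁ : 0 < r + s₁ := by linarith
    have hr₂ : 0 < r + s₂ := by linarith
    obtain ⟨L₁, hL₁, hder₁⟩ := hp.heatOp_eqn H HΦ hf₁ hfs₁ hr₁ x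
    obtain ⟨L₂, hL₂, hder₂⟩ := hp.heatOp_eqn H HΦ hf₂ hfs₂ hr₂ x
    obtain ⟨B₁, hB₁⟩ := hp.exists_bound_heatOp H hf₁ hfs₁ hr₁
    obtain ⟨B₂, hB₂⟩ := hp.exists_bound_heatOp H hf₂ hfs₂ hr₂
    refine ⟨L₁ - L₂, (hL₁.sub hL₂).congr' ?_,
      (hder₁.comp_add_const r s₁).sub (hder₂.comp_add_const r s₂)⟩
    filter_upwards [self_mem_nhdsWithin] with ε hε
    exact (H.Leps_sub hε (hp.continuous_heatOp hf₁ hfs₁ hr₁) (hp.continuous_heatOp hf₂ hfs₂ hr₂)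
      hB₁ hB₂ x).symm

/-- The semigroup property on compactly supported functions. -/
theorem GoodHeatKernel.heatOp_heatOp (hp : GoodHeatKernel d φ J b β Φinv κ p)
    (H : HKAssumptions d φ J a₁ α₁ C₀ a b β κ κ₀ κ₁ κ₂ δ) (HΦ : PhiInvSpec φ Φinv)
    (hf : Continuous f) (hfs : HasCompactSupport f) {s t : ℝ} (hs : 0 < s) (ht : 0 < t)
    (x : EuclideanSpace ℝ (Fin d)) :
    heatOp p (heatOp p f s) t x = heatOp p f (t + s) x := by
  set g := heatOp p f s with hg
  have hgc : Continuous g := hp.continuous_heatOp hf hfs hs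
  have hpi := hp.integrable_right H ht x
  obtain ⟨B, hB⟩ := hp.exists_bound_heatOp H hf hfs hs
  have hI : 0 ≤ ∫ z, ‖p t x z‖ := integral_nonneg fun z => norm_nonneg _
  have key : ∀ η, 0 < η →
      |heatOp p g t x - heatOp p f (t + s) x| ≤ η * (∫ z, ‖p t x z‖) + η := by
    intro η hη
    set gη : EuclideanSpace ℝ (Fin d) → ℝ := fun z => g z - max (-η) (min η (g z)) with hgη
    have hgηc : Continuous gη := by fun_prop
    have hclose : ∀ z, |g z - gη z| ≤ η := fun z => by
      simp only [hgη, sub_sub_cancel]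
      exact abs_le.2 ⟨le_max_left _ _, max_le (by linarith) (min_le_left _ _)⟩
    have hgηs : HasCompactSupport gη := by
      obtain ⟨R, hR⟩ := hp.heatOp_tendsto_zero H hf hfs s hη
      refine HasCompactSupport.intro (isCompact_closedBall 0 R) fun z hz => ?_
      rw [mem_closedBall_zero_iff, not_le] at hz
      have := abs_le.1 (hR s hs le_rfl z hz.le)
      simp only [hgη]
      rw [min_eq_right this.2, max_eq_right this.1, sub_self]
    obtain ⟨Bη, hBη⟩ := hgηc.bounded_above_of_compact_support hgηs
    obtain ⟨C, hC, hlip⟩ := hp.exists_lipschitz_heatOp H HΦ hf hfs hs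
    have hsmall : ∀ η', 0 < η' → ∃ t₀, 0 < t₀ ∧ ∀ r, 0 < r → r < t₀ → ∀ x',
        |heatOp p gη r x' - heatOp p f (r + s) x'| ≤ η + η' := by
      intro η' hη'
      obtain ⟨t₀, ht₀, happ⟩ := hp.approx gη ⟨Bη, hBη⟩
        (hgηs.uniformContinuous_of_continuous hgηc) (η' / 2) (half_pos hη')
      refine ⟨min t₀ (min 1 (η' / (2 * C))), by positivity, fun r hr hrt x' => ?_⟩
      have h1 := happ r hr (hrt.trans_le (min_le_left _ _)) x'
      have hrt' := hrt.le.trans (min_le_right _ _)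
      have h2 := hlip r hr (hrt'.trans (min_le_left _ _)) x'
      have h3 : C * r ≤ η' / 2 := by
        have := hrt'.trans (min_le_right _ _)
        rw [le_div_iff₀ (by positivity)] at this
        linarith
      have h4 := hclose x'
      change |heatOp p gη r x' - gη x'| ≤ _ at h1
      change |_ - g x'| ≤ _ at h2
      rw [abs_le] at h1 h2 h4 ⊢
      constructor <;> linarith [h1.1, h1.2, h2.1, h2.2, h4.1, h4.2]
    have hcmp : |heatOp p gη t x - heatOp p f (t + s) x| ≤ η := by
      have hup := hp.heatOp_sub_heatOp_le H HΦ hgηc hgηs hf hfs (s₁ := 0) (s₂ := s) ht le_rfl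
        hs.le hη.le (fun η' hη' => by
          obtain ⟨t₀, ht₀, h⟩ := hsmall η' hη'
          refine ⟨t₀, ht₀, fun r hr hrt x' => ?_⟩
          rw [add_zero]
          exact (abs_le.1 (h r hr hrt x')).2) x
      have hlow := hp.heatOp_sub_heatOp_le H HΦ hf hfs hgηc hgηs (s₁ := s) (s₂ := 0) ht hs.le
        le_rfl hη.le (fun η' hη' => by
          obtain ⟨t₀, ht₀, h⟩ := hsmall η' hη'
          refine ⟨t₀, ht₀, fun r hr hrt x' => ?_⟩
          rw [add_zero]
          linarith [(abs_le.1 (h r hr hrt x')).1]) x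
      rw [add_zero] at hup hlow
      exact abs_le.2 ⟨by linarith, hup⟩
    have hdiff : |heatOp p g t x - heatOp p gη t x| ≤ η * ∫ z, ‖p t x z‖ := by
      have hgi : Integrable fun z => p t x z * g z :=
        hpi.mul_bdd (c := B) hgc.aestronglyMeasurable (Eventually.of_forall hB)
      rw [heatOp, heatOp, ← integral_sub hgi
        (hp.integrable_mul hgηc hgηs ht x), ← integral_const_mul]
      rw [← Real.norm_eq_abs]
      refine norm_integral_le_of_norm_le (hpi.norm.const_mul η) (Eventually.of_forall fun z => ?_)
      rw [← mul_sub, norm_mul, mul_comm]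
      exact mul_le_mul_of_nonneg_right (hclose z) (norm_nonneg _)
    exact (_root_.abs_sub_le _ (heatOp p gη t x) _).trans (add_le_add hdiff hcmp)
  refine sub_eq_zero.1 (abs_eq_zero.1 (le_antisymm ?_ (abs_nonneg _)))
  refine le_of_forall_pos_le_add fun η hη => ?_
  have := key (η / ((∫ z, ‖p t x z‖) + 1)) (by positivity)
  rw [zero_add]
  refine this.trans (le_of_eq ?_)
  field_simp

theorem GoodHeatKernel.continuous_integral_mul (hp : GoodHeatKernel d φ J b β Φinv κ p)
    (H : HKAssumptions d φ J a₁ α₁ C₀ a b β κ κ₀ κ₁ κ₂ δ) {s t : ℝ} (hs : 0 < s) (ht : 0 < t)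
    (x : EuclideanSpace ℝ (Fin d)) : Continuous fun y => ∫ z, p t x z * p s z y := by
  have hpi := hp.integrable_right H ht x
  refine continuous_iff_continuousAt.2 fun y₀ => ?_
  obtain ⟨B, -, hpB⟩ := hp.exists_bound H hs (‖y₀‖ + 1)
  refine continuousAt_of_dominated (bound := fun z => ‖p t x z‖ * B) ?_ ?_
    (hpi.norm.mul_const B) ?_
  · refine Eventually.of_forall fun y => hpi.aestronglyMeasurable.mul ?_
    exact ((hp.continuous_right hs).comp
      (by fun_prop : Continuous fun z => (z, y))).aestronglyMeasurable
  · filter_upwards [Metric.ball_mem_nhds y₀ one_pos] with y hy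
    refine Eventually.of_forall fun z => ?_
    rw [norm_mul]
    refine mul_le_mul_of_nonneg_left (hpB z y ?_) (norm_nonneg _)
    rw [Metric.mem_ball, dist_eq_norm] at hy
    linarith [norm_sub_norm_le y y₀]
  · refine Eventually.of_forall fun z => (continuous_const.mul ?_).continuousAt
    exact (hp.continuous_right hs).comp (by fun_prop : Continuous fun y => (z, y))

theorem GoodHeatKernel.heatOp_heatOp_eq_integral (hp : GoodHeatKernel d φ J b β Φinv κ p)
    (H : HKAssumptions d φ J a₁ α₁ C₀ a b β κ κ₀ κ₁ κ₂ δ)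
    (hf : Continuous f) (hfs : HasCompactSupport f) {s t : ℝ} (hs : 0 < s) (ht : 0 < t)
    (x : EuclideanSpace ℝ (Fin d)) :
    heatOp p (heatOp p f s) t x = ∫ y, (∫ z, p t x z * p s z y) * f y := by
  obtain ⟨R, -, hR⟩ := hfs.exists_eq_zero_of_lt_norm
  obtain ⟨B, -, hpB⟩ := hp.exists_bound H hs R
  have hprod := (hp.integrable_right H ht x).mul_prod
    (hf.integrable_of_hasCompactSupport (μ := volume) hfs)
  have hint : Integrable (Function.uncurry fun z y => p t x z * p s z y * f y)
      (volume.prod volume) := by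
    refine Integrable.mono' (hprod.norm.const_mul B) ?_ (Eventually.of_forall ?_)
    · refine ((hp.continuous_right hs).aestronglyMeasurable.mul
        hprod.aestronglyMeasurable).congr (Eventually.of_forall fun q => ?_)
      simp only [Pi.mul_apply, Function.uncurry]
      ring
    · rintro ⟨z, y⟩
      simp only [Function.uncurry_apply_pair]
      rw [mul_comm (p t x z), mul_assoc, norm_mul]
      rcases le_or_gt ‖y‖ R with h | h
      · exact mul_le_mul_of_nonneg_right (hpB z y h) (norm_nonneg _)
      · simp [hR y h]
  have hswap := integral_integral_swap hint
  simp only [integral_mul_const] at hswap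
  rw [← hswap]
  simp only [heatOp, mul_assoc, integral_const_mul]

end HeatKernel

/-- Chapman–Kolmogorov equation for the good heat kernel. -/
theorem heat_kernel_chapman_kolmogorov
    (d : ℕ) (φ J : ℝ → ℝ) (a₁ α₁ C₀ a b β : ℝ)
    (κ : EuclideanSpace ℝ (Fin d) → EuclideanSpace ℝ (Fin d) → ℝ)
    (κ₀ κ₁ κ₂ δ : ℝ)
    (H : HKAssumptions d φ J a₁ α₁ C₀ a b β κ κ₀ κ₁ κ₂ δ)
    (Φinv : ℝ → ℝ) (HΦ : PhiInvSpec φ Φinv)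
    (p : ℝ → EuclideanSpace ℝ (Fin d) → EuclideanSpace ℝ (Fin d) → ℝ)
    (hp : GoodHeatKernel d φ J b β Φinv κ p) :
    ∀ s t : ℝ, 0 < s → 0 < t → ∀ x y : EuclideanSpace ℝ (Fin d),
      (∫ z, p t x z * p s z y) = p (t + s) x y := by
  intro s t hs ht x y
  have hts : 0 < t + s := by linarith
  have hk := hp.continuous_integral_mul H hs ht x
  have hpc : Continuous (p (t + s) x) :=
    (hp.continuous_right hts).comp (by fun_prop : Continuous fun y => (x, y))
  have hae : ∀ᵐ y, (∫ z, p t x z * p s z y) - p (t + s) x y = 0 := by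
    refine ae_eq_zero_of_integral_contDiff_smul_eq_zero (hk.sub hpc).locallyIntegrable
      fun f hf hfs => ?_
    have hfc := hf.continuous
    have h := (hp.heatOp_heatOp_eq_integral H hfc hfs hs ht x).symm.trans
      (hp.heatOp_heatOp H HΦ hfc hfs hs ht x)
    have hki : Integrable fun y => (∫ z, p t x z * p s z y) * f y :=
      (hk.mul hfc).integrable_of_hasCompactSupport hfs.mul_left
    rw [heatOp, ← sub_eq_zero, ← integral_sub hki (hp.integrable_mul hfc hfs hts x)] at h
    rw [← h]
    exact integral_congr_ae (Eventually.of_forall fun y => by simp only [smul_eq_mul]; ring)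
  have heq := (Continuous.ae_eq_iff_eq volume (hk.sub hpc) continuous_zero).1 hae
  exact sub_eq_zero.1 (congrFun heq y)
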